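/- arXiv:0901.2331 — 3 statements merged into one kernel-verified Lean document; each statement's English description precedes it below -/
import Mathlib

section
/- Let l ≥ 1 and let p₁, ..., p_s be the distinct prime factors of l. If n ≥ 2 and there exists an n×n complex Hadamard matrix all of whose entries are l-th roots of unity, then there exist natural numbers c₁, ..., c_s with n = c₁p₁ + ... + c_s p_s. -/
/-- Numerical core of the Lam–Leung induction. -/
theorem ll_comb (S : AddSubmonoid ℕ) (p a b : ℕ) (hpS : p ∈ S) (k e : ℕ → ℕ)
    (hab : a ≤ b) (hbp : b + 1 ≤ p) (hK : ∑ i ∈ Finset.range p, k i < a)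
    (H : ∀ i < p, ∀ j < p, k j = 0 → k i + e j < a →
      (∃ s ∈ S, e i = k i + e j + s) ∨ a * b ≤ e i + (k i + e j) * b) :
    (∃ s ∈ S, ∑ i ∈ Finset.range p, e i = ∑ i ∈ Finset.range p, k i + s) ∨
      a * b ≤ ∑ i ∈ Finset.range p, e i + (∑ i ∈ Finset.range p, k i) * b := by
  classical
  have hex : ((Finset.range p).filter (fun i => k i = 0)).Nonempty := by
    by_contra hne
    rw [Finset.not_nonempty_iff_eq_empty, Finset.filter_eq_empty_iff] at hne
    have : ∑ i ∈ Finset.range p, 1 ≤ ∑ i ∈ Finset.range p, k i :=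
      Finset.sum_le_sum (fun i hi => Nat.one_le_iff_ne_zero.2 (hne hi))
    simp at this
    omega
  obtain ⟨j, hj, hmin⟩ := Finset.exists_min_image _ e hex
  simp only [Finset.mem_filter, Finset.mem_range] at hj hmin
  set t := e j with ht
  by_cases hall : ∀ i < p, ∃ s ∈ S, e i = k i + t + s
  · left
    choose! s hs hes using hall
    refine ⟨p * t + ∑ i ∈ Finset.range p, s i, ?_, ?_⟩
    · refine S.add_mem ?_ (S.sum_mem (fun i hi => hs i (Finset.mem_range.1 hi)))
      rw [mul_comm]
      simpa using S.nsmul_mem hpS t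
    · rw [Finset.sum_congr rfl (fun i hi => hes i (Finset.mem_range.1 hi))]
      simp [Finset.sum_add_distrib, add_assoc]
  · right
    push Not at hall
    obtain ⟨i, hip, hi⟩ := hall
    have hmem : i ∈ Finset.range p := Finset.mem_range.2 hip
    have h1 : ∑ x ∈ (Finset.range p).erase i, t ≤
        ∑ x ∈ (Finset.range p).erase i, (e x + t * k x) := by
      refine Finset.sum_le_sum (fun x hx => ?_)
      have hx' := Finset.mem_range.1 (Finset.mem_of_mem_erase hx)
      by_cases h0 : k x = 0
      · have := hmin x ⟨hx', h0⟩
        omega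
      · have : 1 ≤ k x := by omega
        nlinarith
    rw [Finset.sum_add_distrib, ← Finset.mul_sum, Finset.sum_const,
      Finset.card_erase_of_mem hmem, Finset.card_range, smul_eq_mul] at h1
    rw [← Finset.add_sum_erase _ e hmem]
    rw [← Finset.add_sum_erase _ k hmem] at hK ⊢
    generalize ∑ x ∈ (Finset.range p).erase i, e x = E at *
    generalize ∑ x ∈ (Finset.range p).erase i, k x = u at *
    obtain ⟨q, rfl⟩ : ∃ q, p = q + 1 := ⟨p - 1, by omega⟩
    simp only [Nat.add_sub_cancel] at h1
    have hbq : b ≤ q := by omega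
    by_cases hlt : k i + t < a
    · rcases H i hip j hj.1 hj.2 hlt with ⟨s, hs, hes⟩ | h2
      · exact absurd hes (hi s hs)
      · have h3 : t * u ≤ b * u := Nat.mul_le_mul_right _ (by omega)
        have h4 : b * t ≤ q * t := Nat.mul_le_mul_right _ hbq
        nlinarith
    · obtain ⟨v, hv⟩ : ∃ v, a = k i + u + v := ⟨a - (k i + u), by omega⟩
      obtain ⟨w, hw⟩ : ∃ w, q = u + v + k i + w := ⟨q - a, by omega⟩
      -- t ≥ u + v, want v * b ≤ E + e i
      have h5 : (u + v) * (v + k i + w) ≤ t * (v + k i + w) :=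
        Nat.mul_le_mul_right _ (by omega)
      have h6 : v * b ≤ v * q := Nat.mul_le_mul_left _ hbq
      have h7 : t * (v + k i + w) ≤ E := by
        rw [hw] at h1
        nlinarith
      have h8 : v * b ≤ E := by
        rw [hw] at h6
        nlinarith [Nat.zero_le (u * k i), Nat.zero_le (u * w)]
      rw [hv]
      nlinarith

theorem ll_split (p m : ℕ) (θ : ℂ)
    (hθ : ∀ z : ℂ, z ^ (p * m) = 1 → ∃ i < p, ∃ w : ℂ, w ^ m = 1 ∧ z = w * θ ^ i)
    (x : Multiset ℂ) (hx : ∀ z ∈ x, z ^ (p * m) = 1) :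
    ∃ X : ℕ → Multiset ℂ, (∀ i, ∀ z ∈ X i, z ^ m = 1) ∧
      x.sum = ∑ i ∈ Finset.range p, (X i).sum * θ ^ i ∧
      x.card = ∑ i ∈ Finset.range p, (X i).card := by
  classical
  induction x using Multiset.induction_on with
  | empty => exact ⟨fun _ => 0, by simp, by simp, by simp⟩
  | cons z x ih =>
    obtain ⟨X, h1, h2, h3⟩ := ih (fun y hy => hx y (Multiset.mem_cons_of_mem hy))
    obtain ⟨i, hi, w, hw, hz⟩ := hθ z (hx z (Multiset.mem_cons_self _ _))
    refine ⟨fun j => (if j = i then {w} else 0) + X j, ?_, ?_, ?_⟩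
    · intro j y hy
      rcases Multiset.mem_add.1 hy with hy | hy
      · split_ifs at hy
        · rw [Multiset.mem_singleton.1 hy, hw]
        · simp at hy
      · exact h1 j y hy
    · simp only [Multiset.sum_cons, Multiset.sum_add, add_mul, Finset.sum_add_distrib, h2, hz]
      congr 1
      rw [Finset.sum_eq_single i]
      · simp
      · intro b _ hb
        simp [hb]
      · intro h; exact absurd (Finset.mem_range.2 hi) h
    · simp only [Multiset.card_cons, Multiset.card_add, Finset.sum_add_distrib, h3]
      rw [add_comm]
      congr 1
      rw [Finset.sum_eq_single i]
      · simp
      · intro b _ hb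
        simp [hb]
      · intro h; exact absurd (Finset.mem_range.2 hi) h

theorem ll_deg (m M : ℕ) (hm : 0 < m) (hM : 0 < M) (ω η θ : ℂ) (hω : IsPrimitiveRoot ω m)
    (hη : IsPrimitiveRoot η M) (hθ : IsIntegral ℚ θ)
    (hmem : η ∈ IntermediateField.adjoin (IntermediateField.adjoin ℚ {ω}) {θ}) :
    M.totient ≤ m.totient * (minpoly (IntermediateField.adjoin ℚ {ω}) θ).natDegree := by
  have key : ∀ (k : ℕ) (z : ℂ), 0 < k → IsPrimitiveRoot z k →
      Module.finrank ℚ (IntermediateField.adjoin ℚ {z}) = k.totient := by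
    intro k z hk hz
    rw [IntermediateField.adjoin.finrank ((hz.isIntegral hk).tower_top),
      ← Polynomial.cyclotomic_eq_minpoly_rat hz hk, Polynomial.natDegree_cyclotomic]
  have hθ' : IsIntegral (IntermediateField.adjoin ℚ {ω}) θ := hθ.tower_top
  rw [← key m ω hm hω, ← IntermediateField.adjoin.finrank hθ', ← key M η hM hη]
  have : FiniteDimensional ℚ (IntermediateField.adjoin ℚ {ω}) :=
    IntermediateField.adjoin.finiteDimensional ((hω.isIntegral hm).tower_top)
  have : FiniteDimensional (IntermediateField.adjoin ℚ {ω})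
      (IntermediateField.adjoin (IntermediateField.adjoin ℚ {ω}) {θ}) :=
    IntermediateField.adjoin.finiteDimensional hθ'
  rw [Module.finrank_mul_finrank]
  have : FiniteDimensional ℚ
      (IntermediateField.adjoin (IntermediateField.adjoin ℚ {ω}) {θ}) :=
    FiniteDimensional.trans ℚ (IntermediateField.adjoin ℚ {ω}) _
  have hle : IntermediateField.adjoin ℚ {η} ≤
      (IntermediateField.adjoin (IntermediateField.adjoin ℚ {ω}) {θ}).restrictScalars ℚ := by
    rw [IntermediateField.adjoin_le_iff]
    simpa using hmem
  exact LinearMap.finrank_le_finrank_of_injective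
    (f := (IntermediateField.inclusion hle).toLinearMap) (IntermediateField.inclusion hle).injective

theorem ll_sum_mem (m : ℕ) (hm : 0 < m) (ω : ℂ) (hω : IsPrimitiveRoot ω m)
    (x : Multiset ℂ) (hx : ∀ z ∈ x, z ^ m = 1) :
    x.sum ∈ IntermediateField.adjoin ℚ {ω} := by
  have : NeZero m := ⟨hm.ne'⟩
  refine multiset_sum_mem _ (fun z hz => ?_)
  obtain ⟨i, _, rfl⟩ := hω.eq_pow_of_pow_eq_one (hx z hz)
  exact pow_mem (IntermediateField.mem_adjoin_simple_self ℚ ω) i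

/-- independence, case `p ∣ m` -/
theorem ll_indep_dvd (p m : ℕ) (hp : p.Prime) (hm : 0 < m) (hpm : p ∣ m) (η : ℂ)
    (hη : IsPrimitiveRoot η (p * m)) (c : ℕ → ℂ)
    (hc : ∀ i, c i ∈ IntermediateField.adjoin ℚ {η ^ p})
    (h0 : ∑ i ∈ Finset.range p, c i * η ^ i = 0) : ∀ i < p, c i = 0 := by
  have hM : 0 < p * m := Nat.mul_pos hp.pos hm
  have hω : IsPrimitiveRoot (η ^ p) m := hη.pow hM rfl
  have hint : IsIntegral ℚ η := (hη.isIntegral hM).tower_top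
  have hd := ll_deg m (p * m) hm hM (η ^ p) η η hω hη hint
    (IntermediateField.mem_adjoin_simple_self _ η)
  rw [Nat.totient_mul_of_prime_of_dvd hp hpm, mul_comm] at hd
  have hd' := Nat.le_of_mul_le_mul_left hd (Nat.totient_pos.2 hm)
  let F : Polynomial (IntermediateField.adjoin ℚ {η ^ p}) :=
    ∑ i ∈ Finset.range p, Polynomial.C ⟨c i, hc i⟩ * Polynomial.X ^ i
  have hF : Polynomial.aeval η F = 0 := by
    simp only [F, map_sum, map_mul, map_pow, Polynomial.aeval_X, Polynomial.aeval_C]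
    exact h0
  have hdeg : F.degree < p := by
    refine (Polynomial.degree_sum_le _ _).trans_lt ?_
    refine (Finset.sup_lt_iff (WithBot.bot_lt_coe p)).2 ?_
    intro i hi
    refine (Polynomial.degree_C_mul_X_pow_le _ _).trans_lt ?_
    exact WithBot.coe_lt_coe.2 (Finset.mem_range.1 hi)
  have hF0 : F = 0 := by
    by_contra hne
    have h1 := minpoly.degree_le_of_ne_zero _ η hne hF
    have h2 := Polynomial.natDegree_le_natDegree h1
    have h3 := (Polynomial.natDegree_lt_iff_degree_lt hne).2 hdeg
    omega
  intro i hi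
  have h4 : F.coeff i = ⟨c i, hc i⟩ := by
    simp only [F, Polynomial.finsetSum_coeff, Polynomial.coeff_C_mul_X_pow]
    rw [Finset.sum_eq_single i]
    · simp
    · intro b _ hb
      rw [if_neg hb.symm]
    · intro h; exact absurd (Finset.mem_range.2 hi) h
  rw [hF0, Polynomial.coeff_zero] at h4
  exact (congrArg Subtype.val h4).symm

/-- independence, case `p ∤ m` -/
theorem ll_indep_coprime (p m : ℕ) (hp : p.Prime) (hm : 0 < m) (hpm : ¬ p ∣ m) (ω ζ : ℂ)
    (hω : IsPrimitiveRoot ω m) (hζ : IsPrimitiveRoot ζ p) (c : ℕ → ℂ)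
    (hc : ∀ i, c i ∈ IntermediateField.adjoin ℚ {ω})
    (h0 : ∑ i ∈ Finset.range p, c i * ζ ^ i = 0) : ∀ i < p, ∀ j < p, c i = c j := by
  have hM : 0 < p * m := Nat.mul_pos hp.pos hm
  have hη : IsPrimitiveRoot (ζ * ω) (p * m) := by
    have h := (Commute.all ζ ω).orderOf_mul_eq_mul_orderOf_of_coprime
      (by rw [← hω.eq_orderOf, ← hζ.eq_orderOf]; exact (Nat.Prime.coprime_iff_not_dvd hp).2 hpm)
    rw [← hω.eq_orderOf, ← hζ.eq_orderOf] at h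
    rw [← h]
    exact IsPrimitiveRoot.orderOf _
  have hint : IsIntegral ℚ ζ := (hζ.isIntegral hp.pos).tower_top
  have hd := ll_deg m (p * m) hm hM ω (ζ * ω) ζ hω hη hint
    (mul_mem (IntermediateField.mem_adjoin_simple_self _ ζ)
      (IntermediateField.algebraMap_mem _
        (⟨ω, IntermediateField.mem_adjoin_simple_self ℚ ω⟩ : IntermediateField.adjoin ℚ {ω})))
  rw [Nat.totient_mul_of_prime_of_not_dvd hp hpm, mul_comm] at hd
  have hd' := Nat.le_of_mul_le_mul_left hd (Nat.totient_pos.2 hm)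
  -- subtract the top coefficient
  let q := p - 1
  have hgeom : ∑ i ∈ Finset.range p, ζ ^ i = 0 := hζ.geom_sum_eq_zero hp.one_lt
  let F : Polynomial (IntermediateField.adjoin ℚ {ω}) :=
    ∑ i ∈ Finset.range p, Polynomial.C (⟨c i, hc i⟩ - ⟨c q, hc q⟩) * Polynomial.X ^ i
  have hF : Polynomial.aeval ζ F = 0 := by
    simp only [F, map_sum, map_mul, map_pow, Polynomial.aeval_X, Polynomial.aeval_C]
    have : ∑ i ∈ Finset.range p, (c i - c q) * ζ ^ i = 0 := by
      simp only [sub_mul, Finset.sum_sub_distrib, ← Finset.mul_sum, hgeom, h0]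
      simp
    exact this
  have hdeg : F.degree < (q : ℕ) := by
    refine (Polynomial.degree_sum_le _ _).trans_lt ?_
    refine (Finset.sup_lt_iff (WithBot.bot_lt_coe q)).2 ?_
    intro i hi
    by_cases hiq : i = q
    · rw [hiq, sub_self]
      simp
    refine (Polynomial.degree_C_mul_X_pow_le _ _).trans_lt ?_
    have := Finset.mem_range.1 hi
    have : i < q := by omega
    exact WithBot.coe_lt_coe.2 this
  have hF0 : F = 0 := by
    by_contra hne
    have h1 := minpoly.degree_le_of_ne_zero _ ζ hne hF
    have h2 := Polynomial.natDegree_le_natDegree h1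
    have h3 := (Polynomial.natDegree_lt_iff_degree_lt hne).2 hdeg
    omega
  have hall : ∀ i < p, c i = c q := by
    intro i hi
    have h4 : F.coeff i = ⟨c i, hc i⟩ - ⟨c q, hc q⟩ := by
      simp only [F, Polynomial.finsetSum_coeff, Polynomial.coeff_C_mul_X_pow]
      rw [Finset.sum_eq_single i]
      · simp
      · intro b _ hb
        rw [if_neg hb.symm]
      · intro h; exact absurd (Finset.mem_range.2 hi) h
    rw [hF0, Polynomial.coeff_zero] at h4
    have h5 := congrArg Subtype.val (sub_eq_zero.1 h4.symm)
    exact h5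
  intro i hi j hj
  rw [hall i hi, hall j hj]

/-- The main inductive property. -/
def LLGood (S : AddSubmonoid ℕ) (a b m : ℕ) : Prop :=
  ∀ x y : Multiset ℂ, (∀ z ∈ x, z ^ m = 1) → (∀ z ∈ y, z ^ m = 1) → x.sum = y.sum →
    x.card < a → (∃ s ∈ S, y.card = x.card + s) ∨ a * b ≤ y.card + x.card * b

theorem ll_sum_one (x : Multiset ℂ) (hx : ∀ z ∈ x, z ^ 1 = 1) : x.sum = x.card := by
  rw [Multiset.eq_replicate_card.2 (fun z hz => by simpa using hx z hz : ∀ z ∈ x, z = 1)]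
  simp

theorem ll_one (S : AddSubmonoid ℕ) (a b : ℕ) : LLGood S a b 1 := by
  intro x y hx hy hxy _
  rw [ll_sum_one x hx, ll_sum_one y hy] at hxy
  exact Or.inl ⟨0, S.zero_mem, by simpa using (Nat.cast_injective hxy).symm⟩

theorem ll_step_dvd (S : AddSubmonoid ℕ) (a b p m : ℕ) (hp : p.Prime) (hm : 0 < m) (hpm : p ∣ m)
    (ih : LLGood S a b m) : LLGood S a b (p * m) := by
  intro x y hx hy hxy hcard
  have hM : 0 < p * m := Nat.mul_pos hp.pos hm
  have : NeZero (p * m) := ⟨hM.ne'⟩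
  have hη := Complex.isPrimitiveRoot_exp (p * m) hM.ne'
  generalize Complex.exp (2 * Real.pi * Complex.I / ↑(p * m)) = η at hη
  have hω : IsPrimitiveRoot (η ^ p) m := hη.pow hM rfl
  have hθ : ∀ z : ℂ, z ^ (p * m) = 1 → ∃ i < p, ∃ w : ℂ, w ^ m = 1 ∧ z = w * η ^ i := by
    intro z hz
    obtain ⟨j, _, rfl⟩ := hη.eq_pow_of_pow_eq_one hz
    refine ⟨j % p, Nat.mod_lt _ hp.pos, (η ^ p) ^ (j / p), ?_, ?_⟩
    · rw [← pow_mul, mul_comm, pow_mul, hω.pow_eq_one, one_pow]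
    · rw [← pow_mul, ← pow_add, Nat.div_add_mod]
  obtain ⟨X, hX, hXs, hXc⟩ := ll_split p m η hθ x hx
  obtain ⟨Y, hY, hYs, hYc⟩ := ll_split p m η hθ y hy
  have hind := ll_indep_dvd p m hp hm hpm η hη (fun i => (X i).sum - (Y i).sum)
    (fun i => sub_mem (ll_sum_mem m hm _ hω _ (hX i)) (ll_sum_mem m hm _ hω _ (hY i)))
    (by simp only [sub_mul, Finset.sum_sub_distrib, ← hXs, ← hYs, hxy, sub_self])
  have hle : ∀ i < p, (X i).card ≤ x.card := fun i hi => by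
    rw [hXc]
    exact Finset.single_le_sum (f := fun i => (X i).card) (fun _ _ => Nat.zero_le _)
      (Finset.mem_range.2 hi)
  have hle' : ∀ i < p, (Y i).card ≤ y.card := fun i hi => by
    rw [hYc]
    exact Finset.single_le_sum (f := fun i => (Y i).card) (fun _ _ => Nat.zero_le _)
      (Finset.mem_range.2 hi)
  have hgood := fun i (hi : i < p) => ih (X i) (Y i) (hX i) (hY i)
    (sub_eq_zero.1 (hind i hi)) ((hle i hi).trans_lt hcard)
  by_cases hall : ∀ i < p, ∃ s ∈ S, (Y i).card = (X i).card + s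
  · left
    choose! s hs hes using hall
    refine ⟨∑ i ∈ Finset.range p, s i,
      S.sum_mem (fun i hi => hs i (Finset.mem_range.1 hi)), ?_⟩
    rw [hXc, hYc, ← Finset.sum_add_distrib]
    exact Finset.sum_congr rfl (fun i hi => hes i (Finset.mem_range.1 hi))
  · right
    push Not at hall
    obtain ⟨i, hi, hn⟩ := hall
    rcases hgood i hi with ⟨s, hs, hes⟩ | h
    · exact absurd hes (hn s hs)
    · have h1 := Nat.mul_le_mul_right b (hle i hi)
      have h2 := hle' i hi
      omega

/-- Splitting for `p ∤ m`. -/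
theorem ll_split_coprime (p m : ℕ) (hp : p.Prime) (hm : 0 < m) (hpm : ¬ p ∣ m)
    (x y : Multiset ℂ) (hx : ∀ z ∈ x, z ^ (p * m) = 1) (hy : ∀ z ∈ y, z ^ (p * m) = 1)
    (hxy : x.sum = y.sum) :
    ∃ X Y : ℕ → Multiset ℂ, (∀ i, ∀ z ∈ X i, z ^ m = 1) ∧ (∀ i, ∀ z ∈ Y i, z ^ m = 1) ∧
      x.card = ∑ i ∈ Finset.range p, (X i).card ∧ y.card = ∑ i ∈ Finset.range p, (Y i).card ∧
      ∀ i < p, ∀ j < p, (X i).sum - (Y i).sum = (X j).sum - (Y j).sum := by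
  have hM : 0 < p * m := Nat.mul_pos hp.pos hm
  have : NeZero p := ⟨hp.ne_zero⟩
  have hω := Complex.isPrimitiveRoot_exp m hm.ne'
  generalize Complex.exp (2 * Real.pi * Complex.I / ↑m) = ω at hω
  have hζ := Complex.isPrimitiveRoot_exp p hp.ne_zero
  generalize Complex.exp (2 * Real.pi * Complex.I / ↑p) = ζ at hζ
  have hcop : Nat.Coprime p m := (Nat.Prime.coprime_iff_not_dvd hp).2 hpm
  have hθ : ∀ z : ℂ, z ^ (p * m) = 1 → ∃ i < p, ∃ w : ℂ, w ^ m = 1 ∧ z = w * ζ ^ i := by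
    intro z hz
    -- (ζ ^ m) is again a primitive p-th root
    have hζm : IsPrimitiveRoot (ζ ^ m) p := hζ.pow_of_coprime m hcop.symm
    obtain ⟨i, hi, hzi⟩ := hζm.eq_pow_of_pow_eq_one
      (show (z ^ m) ^ p = 1 by rw [← pow_mul, mul_comm, hz])
    have hne : ζ ^ i ≠ 0 := pow_ne_zero _ (hζ.ne_zero hp.ne_zero)
    refine ⟨i, hi, z / ζ ^ i, ?_, (div_mul_cancel₀ z hne).symm⟩
    rw [div_pow, ← hzi, ← pow_mul, ← pow_mul, mul_comm m i, div_self]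
    exact pow_ne_zero _ (hζ.ne_zero hp.ne_zero)
  obtain ⟨X, hX, hXs, hXc⟩ := ll_split p m ζ hθ x hx
  obtain ⟨Y, hY, hYs, hYc⟩ := ll_split p m ζ hθ y hy
  exact ⟨X, Y, hX, hY, hXc, hYc, ll_indep_coprime p m hp hm hpm ω ζ hω hζ
    (fun i => (X i).sum - (Y i).sum)
    (fun i => sub_mem (ll_sum_mem m hm _ hω _ (hX i)) (ll_sum_mem m hm _ hω _ (hY i)))
    (by simp only [sub_mul, Finset.sum_sub_distrib, ← hXs, ← hYs, hxy, sub_self])⟩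

theorem ll_step_coprime (S : AddSubmonoid ℕ) (a b p m : ℕ) (hp : p.Prime) (hm : 0 < m)
    (hpm : ¬ p ∣ m) (hpS : p ∈ S) (hab : a ≤ b) (hbp : b + 1 ≤ p)
    (ih : LLGood S a b m) : LLGood S a b (p * m) := by
  intro x y hx hy hxy hcard
  obtain ⟨X, Y, hX, hY, hXc, hYc, hind⟩ := ll_split_coprime p m hp hm hpm x y hx hy hxy
  rw [hXc] at hcard ⊢
  rw [hYc]
  refine ll_comb S p a b hpS _ _ hab hbp hcard ?_
  intro i hi j hj hj0 hlt
  have h := ih (X i + Y j) (Y i) ?_ (hY i) ?_ (by simpa using hlt)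
  · simpa using h
  · intro z hz
    rcases Multiset.mem_add.1 hz with hz | hz
    · exact hX i z hz
    · exact hY j z hz
  · have h1 := hind i hi j hj
    rw [Multiset.card_eq_zero.1 hj0] at h1
    rw [Multiset.sum_add]
    simp only [Multiset.sum_zero] at h1
    linear_combination h1

theorem ll_step_prime (S : AddSubmonoid ℕ) (a b p : ℕ) (hp : p.Prime) (hpS : p ∈ S)
    (hap : a ≤ p) : LLGood S a b (p * 1) := by
  intro x y hx hy hxy hcard
  obtain ⟨X, Y, hX, hY, hXc, hYc, hind⟩ :=
    ll_split_coprime p 1 hp one_pos (fun h => hp.one_lt.ne' (Nat.dvd_one.1 h)) x y hx hy hxy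
  left
  obtain ⟨j, hj, hj0⟩ : ∃ j < p, (X j).card = 0 := by
    by_contra! hne
    have : ∑ i ∈ Finset.range p, 1 ≤ ∑ i ∈ Finset.range p, (X i).card :=
      Finset.sum_le_sum (fun i hi => Nat.one_le_iff_ne_zero.2 (hne i (Finset.mem_range.1 hi)))
    simp at this
    omega
  refine ⟨p * (Y j).card, ?_, ?_⟩
  · rw [mul_comm]
    simpa using S.nsmul_mem hpS (Y j).card
  · have h : ∀ i ∈ Finset.range p, (Y i).card = (X i).card + (Y j).card := by
      intro i hi
      have h1 := hind i (Finset.mem_range.1 hi) j hj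
      rw [ll_sum_one _ (hX i), ll_sum_one _ (hY i), ll_sum_one _ (hX j), ll_sum_one _ (hY j),
        hj0] at h1
      have h2 : ((Y i).card : ℂ) = ((X i).card + (Y j).card : ℕ) := by
        push_cast at h1 ⊢
        linear_combination -h1
      exact_mod_cast h2
    rw [hXc, hYc, Finset.sum_congr rfl h]
    simp [Finset.sum_add_distrib]

theorem ll_main (S : AddSubmonoid ℕ) (a b : ℕ) (hab : a ≤ b) (m : ℕ) (hm : 0 < m)
    (H : ∀ p, p.Prime → p ∣ m → p ∈ S ∧ (p = a ∨ b + 1 ≤ p)) : LLGood S a b m := by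
  induction m using Nat.strong_induction_on with
  | _ m IH =>
    by_cases h1 : m = 1
    · rw [h1]; exact ll_one S a b
    have hne : m.primeFactors.Nonempty := Nat.nonempty_primeFactors.2 (by omega)
    obtain ⟨p, hpmem, hmax⟩ := Finset.exists_max_image _ id hne
    have hp := Nat.prime_of_mem_primeFactors hpmem
    obtain ⟨m', rfl⟩ := Nat.dvd_of_mem_primeFactors hpmem
    have hm' : 0 < m' := Nat.pos_of_mul_pos_left hm
    obtain ⟨hpS, hpab⟩ := H p hp (dvd_mul_right _ _)
    have ih := IH m' (by nlinarith [hp.two_le]) hm' (fun q hq hqm => H q hq (hqm.mul_left _))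
    by_cases hpm : p ∣ m'
    · exact ll_step_dvd S a b p m' hp hm' hpm ih
    by_cases hm1 : m' = 1
    · rw [hm1]
      exact ll_step_prime S a b p hp hpS (by omega)
    · obtain ⟨q, hq, hqm⟩ := Nat.exists_prime_and_dvd hm1
      have hqp : q ≤ p := hmax q (Nat.mem_primeFactors.2 ⟨hq, hqm.mul_left _, hm.ne'⟩)
      have hqne : q ≠ p := fun h => hpm (h ▸ hqm)
      have hqab := (H q hq (hqm.mul_left _)).2
      exact ll_step_coprime S a b p m' hp hm' hpm hpS hab (by omega) ih

/-- The semigroup generated by the prime factors of `l`. -/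
def llSemi (l : ℕ) : AddSubmonoid ℕ where
  carrier := {n | ∃ c : ℕ → ℕ, n = ∑ p ∈ l.primeFactors, c p * p}
  zero_mem' := ⟨fun _ => 0, by simp⟩
  add_mem' := by
    rintro x y ⟨c, rfl⟩ ⟨d, rfl⟩
    exact ⟨fun p => c p + d p, by simp [add_mul, Finset.sum_add_distrib]⟩

theorem ll_prime_mem (l p : ℕ) (hp : p ∈ l.primeFactors) : p ∈ llSemi l :=
  ⟨fun q => if q = p then 1 else 0, by simp [hp]⟩

theorem lam_leung (l : ℕ) (hl : 1 ≤ l) (y : Multiset ℂ) (hy : ∀ z ∈ y, z ^ l = 1)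
    (hy0 : y.sum = 0) : y.card ∈ llSemi l := by
  have ha0 : 0 < l.minFac := Nat.minFac_pos l
  have hS : ∀ p, p.Prime → p ∣ l → p ∈ llSemi l := fun p hp hpl =>
    ll_prime_mem l p (Nat.mem_primeFactors.2 ⟨hp, hpl, by omega⟩)
  by_cases hq : ∃ q, q.Prime ∧ q ∣ l ∧ q ≠ l.minFac
  · classical
    obtain ⟨hbp, hbl, hbne⟩ := Nat.find_spec hq
    have hbmin := fun {k : ℕ} => Nat.find_min' hq (m := k)
    generalize Nat.find hq = b at *
    have hap : l.minFac.Prime := Nat.minFac_prime (by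
      rintro rfl
      exact hbp.one_lt.ne' (Nat.dvd_one.1 hbl))
    have hab : l.minFac ≤ b := Nat.minFac_le_of_dvd hbp.two_le hbl
    have := ll_main (llSemi l) l.minFac (b - 1) (by omega) l hl (fun p hp hpl =>
      ⟨hS p hp hpl, by
        by_cases h : p = l.minFac
        · exact Or.inl h
        · have := hbmin ⟨hp, hpl, h⟩
          have := hbp.two_le
          right; omega⟩)
    rcases this 0 y (by simp) hy (by simp [hy0]) (by simpa using ha0) with ⟨s, hs, hes⟩ | h
    · rw [hes]; simpa using hs
    · have hcop : Nat.Coprime l.minFac b := (Nat.coprime_primes hap hbp).2 hbne.symm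
      have hbig : (l.minFac - 1) * (b - 1) ≤ y.card := by
        refine le_trans (Nat.mul_le_mul_right _ (Nat.sub_le _ _)) ?_
        simpa using h
      obtain ⟨u, v, huv⟩ := Nat.exists_add_mul_eq_of_gcd_dvd_of_mul_pred_le l.minFac b y.card
        (by rw [hcop.gcd_eq_one]; exact one_dvd _) hbig
      rw [← huv]
      refine (llSemi l).add_mem ?_ ?_
      · simpa using (llSemi l).nsmul_mem (hS _ hap (Nat.minFac_dvd l)) u
      · simpa using (llSemi l).nsmul_mem (hS _ hbp hbl) v
  · push Not at hq
    have := ll_main (llSemi l) l.minFac (l.minFac + y.card) (by omega) l hl (fun p hp hpl =>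
      ⟨hS p hp hpl, Or.inl (hq p hp hpl)⟩)
    rcases this 0 y (by simp) hy (by simp [hy0]) (by simpa using ha0) with ⟨s, hs, hes⟩ | h
    · rw [hes]; simpa using hs
    · simp at h
      nlinarith

/-- Lam–Leung obstruction: If `n ≥ 2` and there is an `n×n` complex
Hadamard matrix all of whose entries are `l`-th roots of unity (`l ≥ 1`), then `n` is a
ℕ-linear combination of the distinct prime factors of `l`. -/
theorem stmt_8 (l n : ℕ) (hl : 1 ≤ l) (hn : 2 ≤ n)
    (h : Matrix (Fin n) (Fin n) ℂ)
    (hmod : ∀ i j, ‖h i j‖ = 1)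
    (hent : ∀ i j, h i j ^ l = 1)
    (horth : ∀ i₁ i₂, i₁ ≠ i₂ → ∑ k, h i₁ k * (starRingEnd ℂ) (h i₂ k) = 0) :
    ∃ c : ℕ → ℕ, n = ∑ p ∈ l.primeFactors, c p * p := by
  let i₁ : Fin n := ⟨0, by omega⟩
  let i₂ : Fin n := ⟨1, by omega⟩
  have hne : i₁ ≠ i₂ := by simp [i₁, i₂]
  have := lam_leung l hl
    ((Finset.univ : Finset (Fin n)).val.map (fun k => h i₁ k * (starRingEnd ℂ) (h i₂ k)))
    (by
      intro z hz
      obtain ⟨k, _, rfl⟩ := Multiset.mem_map.1 hz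
      rw [mul_pow, ← map_pow, hent, hent, map_one, mul_one])
    (horth i₁ i₂ hne)
  have h2 : n ∈ llSemi l := by simpa using this
  exact h2
end

section
/- If there exists a 5×5 complex Hadamard matrix all of whose entries are l-th roots of unity, then 5 divides l. -/
lemma key_sym {K : Type*} [Field K] (h5 : (5 : K) = 0) (x0 x1 x2 x3 x4 a b c d : K)
    (ha : a ≠ 0) (hb : b ≠ 0) (hc : c ≠ 0) (hd : d ≠ 0)
    (e1 : x0 + x1 + x2 + x3 + x4 = 0)
    (hx : x1*x2*x3*x4 + x0*x2*x3*x4 + x0*x1*x3*x4 + x0*x1*x2*x4 + x0*x1*x2*x3 = 0)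
    (hy : (a+b*x1)*(a+b*x2)*(a+b*x3)*(a+b*x4) + (a+b*x0)*(a+b*x2)*(a+b*x3)*(a+b*x4)
      + (a+b*x0)*(a+b*x1)*(a+b*x3)*(a+b*x4) + (a+b*x0)*(a+b*x1)*(a+b*x2)*(a+b*x4)
      + (a+b*x0)*(a+b*x1)*(a+b*x2)*(a+b*x3) = 0)
    (hz : (c+d*x1)*(c+d*x2)*(c+d*x3)*(c+d*x4) + (c+d*x0)*(c+d*x2)*(c+d*x3)*(c+d*x4)
      + (c+d*x0)*(c+d*x1)*(c+d*x3)*(c+d*x4) + (c+d*x0)*(c+d*x1)*(c+d*x2)*(c+d*x4)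
      + (c+d*x0)*(c+d*x1)*(c+d*x2)*(c+d*x3) = 0)
    (hne : a * d ≠ c * b) : x1 = x0 ∧ x2 = x0 ∧ x3 = x0 ∧ x4 = x0 := by
  obtain ⟨e2, he2⟩ : ∃ e2, e2 = x0*x1+x0*x2+x0*x3+x0*x4+x1*x2+x1*x3+x1*x4+x2*x3+x2*x4+x3*x4 :=
    ⟨_, rfl⟩
  obtain ⟨e3, he3⟩ : ∃ e3, e3 = x0*x1*x2+x0*x1*x3+x0*x1*x4+x0*x2*x3+x0*x2*x4+x0*x3*x4
    +x1*x2*x3+x1*x2*x4+x1*x3*x4+x2*x3*x4 := ⟨_, rfl⟩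
  have gen : ∀ a b : K, a ≠ 0 → b ≠ 0 →
      (a+b*x1)*(a+b*x2)*(a+b*x3)*(a+b*x4) + (a+b*x0)*(a+b*x2)*(a+b*x3)*(a+b*x4)
      + (a+b*x0)*(a+b*x1)*(a+b*x3)*(a+b*x4) + (a+b*x0)*(a+b*x1)*(a+b*x2)*(a+b*x4)
      + (a+b*x0)*(a+b*x1)*(a+b*x2)*(a+b*x3) = 0 → 3*a*e2+2*b*e3 = 0 := by
    intro a b ha hb h
    have : (a*b^2) * (3*a*e2+2*b*e3) = 0 := by
      rw [he2, he3]
      linear_combination h - a^4*h5 - 4*a^3*b*e1 - b^4*hx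
    exact (mul_eq_zero.mp this).resolve_left (mul_ne_zero ha (pow_ne_zero _ hb))
  have h1 := gen a b ha hb hy
  have h2 := gen c d hc hd hz
  have hne' : a * d - c * b ≠ 0 := sub_ne_zero.mpr hne
  have E2 : e2 = 0 := by
    have : (a*d-c*b) * e2 = 0 := by linear_combination 2*(d*h1-b*h2) - (a*d-c*b)*e2*h5
    exact (mul_eq_zero.mp this).resolve_left hne'
  have E3 : e3 = 0 := by
    have : (a*d-c*b) * e3 = 0 := by linear_combination 3*(a*h2-c*h1) - (a*d-c*b)*e3*h5
    exact (mul_eq_zero.mp this).resolve_left hne'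
  have fin : ∀ t : K, (t-x0)*(t-x1)*(t-x2)*(t-x3)*(t-x4) = 0 → t = x0 := by
    intro t ht
    have A : ∀ t : K, (t-x0)*(t-x1)*(t-x2)*(t-x3)*(t-x4) = t^5 - x0*x1*x2*x3*x4 := by
      intro t
      linear_combination (-t^4)*e1 + t^3*(E2-he2) - t^2*(E3-he3) + t*hx
    have B := A x0
    rw [A] at ht
    have : (t-x0)^5 = 0 := by
      have B' : x0^5 - x0*x1*x2*x3*x4 = 0 := by rw [← B]; ring
      linear_combination ht - B' + (-t^4*x0+2*t^3*x0^2-2*t^2*x0^3+t*x0^4)*h5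
    exact sub_eq_zero.mp (pow_eq_zero_iff (by norm_num) |>.mp this)
  exact ⟨fin _ (by ring), fin _ (by ring), fin _ (by ring), fin _ (by ring)⟩

lemma e4_of_inv {K : Type*} [Field K] (y : Fin 5 → K) (hy : ∀ i, y i ≠ 0)
    (h : ∑ i, (y i)⁻¹ = 0) :
    y 1*y 2*y 3*y 4 + y 0*y 2*y 3*y 4 + y 0*y 1*y 3*y 4 + y 0*y 1*y 2*y 4
      + y 0*y 1*y 2*y 3 = 0 := by
  simp only [Fin.sum_univ_five] at h
  have h0 := hy 0
  have h1 := hy 1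
  have h2 := hy 2
  have h3 := hy 3
  have h4 := hy 4
  field_simp at h
  linear_combination h

lemma no_rank_two {K : Type*} [Field K] (h5 : (5 : K) = 0) (V : Matrix (Fin 5) (Fin 5) K)
    (hV : ∀ i j, V i j ≠ 0)
    (ho : ∀ i j, i ≠ j → ∑ k, V i k * (V j k)⁻¹ = 0)
    (hp : ∀ i j, i ≠ j → ∀ c : K, ¬ ∀ k, V i k = c * V j k)
    (hr : V.rank ≤ 2) : False := by
  have span : ∀ i, i ≠ 0 → i ≠ 1 → ∃ a b : K, a ≠ 0 ∧ b ≠ 0 ∧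
      ∀ k, V i k = a * V 0 k + b * V 1 k := by
    intro i hi0 hi1
    have hdep : ¬ LinearIndependent K ![V.row i, V.row 0, V.row 1] := by
      intro hl
      have h3 := finrank_span_eq_card hl
      have h4 : Submodule.span K (Set.range ![V.row i, V.row 0, V.row 1]) ≤
          Submodule.span K (Set.range V.row) := by
        apply Submodule.span_mono
        rintro _ ⟨r, rfl⟩
        fin_cases r
        · exact ⟨i, rfl⟩
        · exact ⟨0, rfl⟩
        · exact ⟨1, rfl⟩
      have h5 := Submodule.finrank_mono h4
      rw [← Matrix.rank_eq_finrank_span_row, h3, Fintype.card_fin] at h5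
      omega
    have hind : LinearIndependent K ![V.row 0, V.row 1] := by
      rw [LinearIndependent.pair_iff]
      intro s t hst
      have hst' : ∀ k, s * V 0 k + t * V 1 k = 0 := fun k => by simpa using congrFun hst k
      have ht : t = 0 := by
        by_contra ht
        refine hp 1 0 (by decide) (-s/t) fun k => ?_
        field_simp
        linear_combination hst' k
      refine ⟨?_, ht⟩
      have := hst' 0
      simpa [ht, hV] using this
    have hmem : V.row i ∈ Submodule.span K (Set.range ![V.row 0, V.row 1]) := by
      by_contra hh
      exact hdep (linearIndependent_finCons.mpr ⟨hind, hh⟩)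
    simp only [Matrix.range_cons, Matrix.range_empty, Set.union_empty,
      Set.singleton_union, Submodule.mem_span_pair] at hmem
    obtain ⟨a, b, hab⟩ := hmem
    have hab' : ∀ k, V i k = a * V 0 k + b * V 1 k := fun k => by
      simpa using (congrFun hab k).symm
    refine ⟨a, b, ?_, ?_, hab'⟩
    · rintro rfl
      exact hp i 1 hi1 b fun k => by simpa using hab' k
    · rintro rfl
      exact hp i 0 hi0 a fun k => by simpa using hab' k
  obtain ⟨a, b, ha, hb, hab⟩ := span 2 (by decide) (by decide)
  obtain ⟨c, d, hc, hd, hcd⟩ := span 3 (by decide) (by decide)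
  have e4 : ∀ i : Fin 5, i ≠ 0 → _ := fun i hi => e4_of_inv (fun k => V i k * (V 0 k)⁻¹)
    (fun k => mul_ne_zero (hV _ _) (inv_ne_zero (hV _ _)))
    (by rw [← ho 0 i hi.symm]; refine Finset.sum_congr rfl fun k _ => ?_
        rw [mul_inv, inv_inv, mul_comm])
  have e41 := e4 1 (by decide)
  have e42 := e4 2 (by decide)
  have e43 := e4 3 (by decide)
  have e1 := ho 1 0 (by decide)
  rw [Fin.sum_univ_five] at e1
  have y2 : ∀ k, V 2 k * (V 0 k)⁻¹ = a + b * (V 1 k * (V 0 k)⁻¹) := fun k => by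
    rw [hab]; have := hV 0 k; field_simp
  have y3 : ∀ k, V 3 k * (V 0 k)⁻¹ = c + d * (V 1 k * (V 0 k)⁻¹) := fun k => by
    rw [hcd]; have := hV 0 k; field_simp
  simp only [y2] at e42
  simp only [y3] at e43
  by_cases hne : a * d = c * b
  · refine hp 2 3 (by decide) (a / c) fun k => ?_
    rw [hab, hcd]
    field_simp
    linear_combination (-V 1 k) * hne
  · obtain ⟨q1, q2, q3, q4⟩ := key_sym h5 _ _ _ _ _ a b c d ha hb hc hd e1 e41 e42 e43 hne
    refine hp 1 0 (by decide) (V 1 0 * (V 0 0)⁻¹) fun k => ?_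
    have : V 1 k * (V 0 k)⁻¹ = V 1 0 * (V 0 0)⁻¹ := by
      fin_cases k
      · rfl
      · exact q1
      · exact q2
      · exact q3
      · exact q4
    rw [← this]
    have := hV 0 k
    field_simp

lemma no_char_five {K : Type*} [Field K] (h5 : (5 : K) = 0) (V : Matrix (Fin 5) (Fin 5) K)
    (hV : ∀ i j, V i j ≠ 0)
    (ho : ∀ i j, i ≠ j → ∑ k, V i k * (V j k)⁻¹ = 0)
    (hp : ∀ i j, i ≠ j → ∀ c : K, ¬ ∀ k, V i k = c * V j k) : False := by
  let W : Matrix (Fin 5) (Fin 5) K := Matrix.of fun i j => (V i j)⁻¹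
  have hVW : V * W.transpose = 0 := by
    ext i j
    rw [Matrix.mul_apply]
    by_cases hij : i = j
    · subst hij
      simp [W, hV, h5]
    · simpa [W] using ho i j hij
  have hrk := Matrix.rank_add_rank_le_card_of_mul_eq_zero hVW
  rw [Matrix.rank_transpose, Fintype.card_fin] at hrk
  by_cases h2 : V.rank ≤ 2
  · exact no_rank_two h5 V hV ho hp h2
  · refine no_rank_two h5 W (fun i j => inv_ne_zero (hV i j)) ?_ ?_ (by omega)
    · intro i j hij
      rw [← ho j i hij.symm]
      refine Finset.sum_congr rfl fun k _ => ?_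
      simp [W, mul_comm]
    · intro i j hij c hc
      refine hp i j hij c⁻¹ fun k => ?_
      have := hc k
      simp only [W, Matrix.of_apply] at this
      rw [← inv_inv (V i k), this, mul_inv, inv_inv]

/-- Haagerup obstruction: If there is a 5×5 complex Hadamard matrix all
of whose entries are `l`-th roots of unity, then `5 ∣ l`. -/
theorem stmt_10 (l : ℕ) (h : Matrix (Fin 5) (Fin 5) ℂ)
    (hmod : ∀ i j, ‖h i j‖ = 1)
    (hent : ∀ i j, h i j ^ l = 1)
    (horth : ∀ i₁ i₂, i₁ ≠ i₂ → ∑ k, h i₁ k * (starRingEnd ℂ) (h i₂ k) = 0) :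
    5 ∣ l := by
  by_contra hl5
  have hl : l ≠ 0 := by rintro rfl; simp at hl5
  have hconj : ∀ i j, (starRingEnd ℂ) (h i j) = h i j ^ (l-1) := by
    intro i j
    have h0 : h i j ≠ 0 := by intro h0; have := hmod i j; simp [h0] at this
    rw [← Complex.inv_eq_conj (hmod i j)]
    apply inv_eq_of_mul_eq_one_left
    rw [pow_sub_one_mul hl, hent]
  let R := integralClosure ℤ ℂ
  let u : Fin 5 → Fin 5 → R := fun i j =>
    ⟨h i j, IsIntegral.of_pow (Nat.pos_of_ne_zero hl) (by rw [hent]; exact isIntegral_one)⟩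
  have hu : ∀ i j, u i j ^ l = 1 := fun i j => Subtype.ext (by simpa [u] using hent i j)
  have huo : ∀ i j, i ≠ j → ∑ k, u i k * u j k ^ (l-1) = 0 := by
    intro i j hij
    apply Subtype.ext
    have := horth i j hij
    simp only [hconj] at this
    simpa [u] using this
  have h5 : ¬ IsUnit (5 : R) := by
    intro hu5
    obtain ⟨v, hv⟩ := hu5.exists_right_inv
    have hv' : (5 : ℂ) * (v : ℂ) = 1 := by
      exact congrArg (Subtype.val) hv
    have hvi : IsIntegral ℤ (v : ℂ) := v.2
    have hvq : (v : ℂ) = algebraMap ℚ ℂ (1/5) := by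
      simp
      field_simp
      linear_combination hv'
    rw [hvq, isIntegral_algebraMap_iff (algebraMap ℚ ℂ).injective] at hvi
    obtain ⟨n, hn⟩ := IsIntegrallyClosed.isIntegral_iff.mp hvi
    have h1 : (n : ℚ) * 5 = 1 := by
      have : (n : ℚ) = 1/5 := by simpa using hn
      rw [this]; norm_num
    have h2 : n * 5 = 1 := by exact_mod_cast h1
    omega
  obtain ⟨M, hM, h5M⟩ := exists_max_ideal_of_mem_nonunits h5
  letI : Field (R ⧸ M) := Ideal.Quotient.field M
  let f : R →+* (R ⧸ M) := Ideal.Quotient.mk M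
  have hf5 : (5 : R ⧸ M) = 0 := by
    have : f 5 = 0 := Ideal.Quotient.eq_zero_iff_mem.mpr h5M
    rw [← this]
    exact (map_ofNat f 5).symm
  have hinj : ∀ r : R, r ^ l = 1 → f r = 1 → r = 1 := by
    intro r hr hfr
    by_contra hne
    have hs : ∑ i ∈ Finset.range l, r ^ i = 0 := by
      have := geom_sum_mul r l
      rw [hr, sub_self] at this
      exact (mul_eq_zero.mp this).resolve_right (sub_ne_zero.mpr hne)
    have hs' := congrArg f hs
    simp only [map_sum, map_pow, hfr, one_pow, map_zero, Finset.sum_const, Finset.card_range,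
      nsmul_eq_mul, mul_one] at hs'
    have hcop : IsCoprime (5 : ℤ) (l : ℤ) := by
      rw [show (5 : ℤ) = ((5 : ℕ) : ℤ) from rfl, Nat.isCoprime_iff_coprime]
      exact (Nat.Prime.coprime_iff_not_dvd (by norm_num)).mpr hl5
    obtain ⟨s, t, hst⟩ := hcop
    have := congrArg (Int.cast : ℤ → R ⧸ M) hst
    push_cast at this
    rw [hf5, hs'] at this
    simp at this
  have hfu : ∀ i j, f (u i j) ^ l = 1 := fun i j => by rw [← map_pow, hu, map_one]
  have hne0 : ∀ i j, f (u i j) ≠ 0 := fun i j h0 => by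
    have := hfu i j
    rw [h0, zero_pow hl] at this
    exact zero_ne_one this
  have hinv : ∀ i j, (f (u i j))⁻¹ = f (u i j) ^ (l-1) := fun i j => by
    apply inv_eq_of_mul_eq_one_left
    rw [pow_sub_one_mul hl, hfu]
  refine no_char_five (K := R ⧸ M) hf5 (Matrix.of fun i j => f (u i j)) (fun i j => hne0 i j) ?_ ?_
  · intro i j hij
    have := congrArg f (huo i j hij)
    simpa [hinv] using this
  · intro i j hij c hc
    have hc' : ∀ k, f (u i k * u j k ^ (l-1)) = c := fun k => by
      have := hc k
      simp only [Matrix.of_apply] at this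
      rw [map_mul, map_pow, ← hinv, this, mul_assoc, mul_inv_cancel₀ (hne0 j k), mul_one]
    have hone : ∀ k, u j k * u j k ^ (l-1) = 1 := fun k => by
      rw [mul_pow_sub_one hl, hu]
    -- all ratios equal the ratio in column 0
    have hwl : ∀ k, (u i k * u j k ^ (l-1)) ^ l = 1 := fun k => by
      rw [mul_pow, hu, ← pow_mul, mul_comm (l-1), pow_mul, hu, one_pow, one_mul]
    have heq : ∀ k, u i k * u j k ^ (l-1) = u i 0 * u j 0 ^ (l-1) := by
      intro k
      set w := u i k * u j k ^ (l-1) with hw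
      set w0 := u i 0 * u j 0 ^ (l-1) with hw0
      have hw0l : w0 * w0 ^ (l-1) = 1 := by rw [mul_pow_sub_one hl]; exact hwl 0
      have h1 : w * w0 ^ (l-1) = 1 := by
        apply hinj
        · rw [mul_pow, hwl k, ← pow_mul, mul_comm (l-1), pow_mul, hwl 0, one_pow, one_mul]
        · rw [map_mul, hc' k, ← hc' 0, ← map_mul, hw0l, map_one]
      linear_combination w0 * h1 - w * hw0l
    have hsum := huo i j hij
    simp only [heq, Finset.sum_const, Finset.card_univ, Fintype.card_fin] at hsum
    have h50 : (5 : R) ≠ 0 := by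
      intro h0
      have := congrArg Subtype.val h0
      simp at this
    rw [nsmul_eq_mul] at hsum
    have hz := (mul_eq_zero.mp hsum).resolve_left (by exact_mod_cast h50)
    have := hwl 0
    rw [hz, zero_pow hl] at this
    exact zero_ne_one this
end

section
/- Let j = exp(2πi/3). A 6×6 complex Hadamard matrix h has the property that for every pair of distinct rows i₁ ≠ i₂ the multiset { h_{i₁k}·conj(h_{i₂k}) : 1 ≤ k ≤ 6 } equals { x, jx, j²x, y, jy, j²y } for some unimodular x, y, if and only if h is equivalent to the Tao matrix T. -/
/-- The primitive cube root of unity `j = exp(2πi/3)`. -/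
noncomputable def ω : ℂ := Complex.exp (2 * Real.pi * Complex.I / 3)

/-- The multiset of entrywise products `h i₁ k * conj (h i₂ k)` of two rows of `h`. -/
def rowProd {m n : ℕ} (h : Matrix (Fin m) (Fin n) ℂ) (i₁ i₂ : Fin m) : Multiset ℂ :=
  Multiset.map (fun k => h i₁ k * (starRingEnd ℂ) (h i₂ k)) Finset.univ.val

/-- The pair of rows `(i₁, i₂)` is binary: the multiset of entrywise products is
`{x, -x, y, -y, z, -z}` for some unimodular `x, y, z`. -/
def BinaryPair {m n : ℕ} (h : Matrix (Fin m) (Fin n) ℂ) (i₁ i₂ : Fin m) : Prop :=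
  ∃ x y z : ℂ, ‖x‖ = 1 ∧ ‖y‖ = 1 ∧ ‖z‖ = 1 ∧
    rowProd h i₁ i₂ = {x, -x, y, -y, z, -z}

/-- The pair of rows `(i₁, i₂)` is ternary: the multiset of entrywise products is
`{x, jx, j²x, y, jy, j²y}` for some unimodular `x, y`. -/
def TernaryPair {m n : ℕ} (h : Matrix (Fin m) (Fin n) ℂ) (i₁ i₂ : Fin m) : Prop :=
  ∃ x y : ℂ, ‖x‖ = 1 ∧ ‖y‖ = 1 ∧
    rowProd h i₁ i₂ = {x, ω * x, ω ^ 2 * x, y, ω * y, ω ^ 2 * y}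

/-- Hadamard equivalence: `k` is obtained from `h` by permuting rows and columns and
multiplying rows and columns by unimodular scalars. -/
def MatEquiv {m n : ℕ} (h k : Matrix (Fin m) (Fin n) ℂ) : Prop :=
  ∃ (σ : Equiv.Perm (Fin m)) (τ : Equiv.Perm (Fin n)) (a : Fin m → ℂ) (b : Fin n → ℂ),
    (∀ i, ‖a i‖ = 1) ∧ (∀ j, ‖b j‖ = 1) ∧
    ∀ i j, k i j = a i * b j * h (σ i) (τ j)

/-- `h` is a complex Hadamard matrix: unimodular entries and pairwise orthogonal rows. -/
def IsCHM {n : ℕ} (h : Matrix (Fin n) (Fin n) ℂ) : Prop :=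
  (∀ i j, ‖h i j‖ = 1) ∧
  ∀ i₁ i₂, i₁ ≠ i₂ → ∑ k, h i₁ k * (starRingEnd ℂ) (h i₂ k) = 0

/-- The Tao matrix. -/
noncomputable def TaoM : Matrix (Fin 6) (Fin 6) ℂ :=
  !![1, 1,     1,     1,     1,     1;
     1, 1,     ω,     ω,     ω ^ 2, ω ^ 2;
     1, ω,     1,     ω ^ 2, ω ^ 2, ω;
     1, ω,     ω ^ 2, 1,     ω,     ω ^ 2;
     1, ω ^ 2, ω ^ 2, ω,     1,     ω;
     1, ω ^ 2, ω,     ω ^ 2, ω,     1]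


theorem map_univ_eq_iff' {α β : Type*} [Fintype α] (f g : α → β) :
    Multiset.map f Finset.univ.val = Multiset.map g Finset.univ.val ↔
      ∃ σ : Equiv.Perm α, f = g ∘ σ := by
  classical
  constructor
  · intro h
    have hc : ∀ c, Fintype.card {a // f a = c} = Fintype.card {a // g a = c} := by
      intro c
      have := congrArg (Multiset.count c) h
      rw [Multiset.count_map, Multiset.count_map] at this
      rw [Fintype.card_subtype, Fintype.card_subtype]
      simp only [Finset.card_def, Finset.filter_val]
      simpa only [eq_comm] using this
    refine ⟨Equiv.ofFiberEquiv (f := f) (g := g) fun c => Fintype.equivOfCardEq (hc c), ?_⟩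
    funext a
    exact (Equiv.ofFiberEquiv_map _ a).symm
  · rintro ⟨σ, rfl⟩
    rw [← Multiset.map_map, Multiset.map_univ_val_equiv]

theorem ω_cube : ω ^ 3 = 1 := by
  unfold ω
  rw [← Complex.exp_nat_mul, ← Complex.exp_two_pi_mul_I]
  congr 1; push_cast; ring

theorem ω_prim : IsPrimitiveRoot ω 3 := by
  have := Complex.isPrimitiveRoot_exp 3 (by norm_num)
  simpa [ω] using this

theorem ω_norm : ‖ω‖ = 1 := Complex.norm_eq_one_of_pow_eq_one ω_cube (by norm_num)

theorem ω_ne : ω ≠ 0 := by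
  intro h; have := ω_norm; simp [h] at this

/-- Exponential character of `ZMod 3`. -/
noncomputable def ee (d : ZMod 3) : ℂ := ω ^ d.val

theorem ee_add (a b : ZMod 3) : ee (a + b) = ee a * ee b := by
  unfold ee
  rw [← pow_add, ZMod.val_add]
  conv_rhs => rw [← Nat.mod_add_div (a.val + b.val) 3, pow_add, pow_mul, ω_cube, one_pow, mul_one]

theorem ee_zero : ee 0 = 1 := by simp [ee]

theorem ee_one : ee 1 = ω := by
  have : (1 : ZMod 3).val = 1 := rfl
  simp [ee, this]

theorem ee_two : ee 2 = ω ^ 2 := by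
  have : (2 : ZMod 3).val = 2 := rfl
  simp [ee, this]

theorem ee_norm (a : ZMod 3) : ‖ee a‖ = 1 := by simp [ee, ω_norm]

theorem ee_inj : Function.Injective ee := by
  intro a b h
  exact ZMod.val_injective 3 (ω_prim.pow_inj (ZMod.val_lt a) (ZMod.val_lt b) h)

theorem ee_cube (a : ZMod 3) : ee a ^ 3 = 1 := by
  unfold ee; rw [← pow_mul, mul_comm, pow_mul, ω_cube, one_pow]

theorem exists_ee {c : ℂ} (h : c ^ 3 = 1) : ∃ d, c = ee d := by
  obtain ⟨i, hi, h⟩ := ω_prim.eq_pow_of_pow_eq_one h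
  exact ⟨(i : ZMod 3), by rw [ee, ZMod.val_natCast, Nat.mod_eq_of_lt hi, h]⟩

theorem mul_conj_one {c : ℂ} (h : ‖c‖ = 1) : c * (starRingEnd ℂ) c = 1 := by
  rw [Complex.mul_conj, Complex.normSq_eq_norm_sq, h]; simp

theorem ee_conj (a : ZMod 3) : (starRingEnd ℂ) (ee a) = ee (-a) := by
  have h1 := mul_conj_one (ee_norm a)
  have h2 : ee a * ee (-a) = 1 := by rw [← ee_add, add_neg_cancel, ee_zero]
  have h3 : ee a ≠ 0 := by intro h; simp [h] at h2
  exact mul_left_cancel₀ h3 (h1.trans h2.symm)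

theorem ee_sub (a b : ZMod 3) : ee a * (starRingEnd ℂ) (ee b) = ee (a - b) := by
  rw [ee_conj, ← ee_add, sub_eq_add_neg]

theorem MatEquiv.symm' {m n : ℕ} {h k : Matrix (Fin m) (Fin n) ℂ} (H : MatEquiv h k) :
    MatEquiv k h := by
  obtain ⟨σ, τ, a, b, ha, hb, H⟩ := H
  refine ⟨σ.symm, τ.symm, fun i => (starRingEnd ℂ) (a (σ.symm i)),
    fun j => (starRingEnd ℂ) (b (τ.symm j)), by simp [ha], by simp [hb], fun i j => ?_⟩
  rw [H]
  have h1 := mul_conj_one (ha (σ.symm i))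
  have h2 := mul_conj_one (hb (τ.symm j))
  simp only [Equiv.apply_symm_apply]
  linear_combination (- h i j) * h1 - (a (σ.symm i) * (starRingEnd ℂ) (a (σ.symm i)) * h i j) * h2

theorem MatEquiv.trans' {m n : ℕ} {h k l : Matrix (Fin m) (Fin n) ℂ} (H : MatEquiv h k)
    (K : MatEquiv k l) : MatEquiv h l := by
  obtain ⟨σ, τ, a, b, ha, hb, H⟩ := H
  obtain ⟨σ', τ', a', b', ha', hb', K⟩ := K
  refine ⟨σ'.trans σ, τ'.trans τ, fun i => a' i * a (σ' i), fun j => b' j * b (τ' j),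
    by simp [ha, ha'], by simp [hb, hb'], fun i j => ?_⟩
  rw [K, H]
  simp only [Equiv.trans_apply]
  ring

theorem ternary_equiv {m n : ℕ} {h k : Matrix (Fin m) (Fin n) ℂ} (H : MatEquiv h k)
    (T : ∀ i₁ i₂, i₁ ≠ i₂ → TernaryPair h i₁ i₂) :
    ∀ i₁ i₂, i₁ ≠ i₂ → TernaryPair k i₁ i₂ := by
  obtain ⟨σ, τ, a, b, ha, hb, H⟩ := H
  intro i₁ i₂ hi
  obtain ⟨x, y, hx, hy, hxy⟩ := T (σ i₁) (σ i₂) (σ.injective.ne hi)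
  refine ⟨a i₁ * (starRingEnd ℂ) (a i₂) * x, a i₁ * (starRingEnd ℂ) (a i₂) * y,
    by simp [ha, hx], by simp [ha, hy], ?_⟩
  have e1 : rowProd k i₁ i₂ = Multiset.map (fun z => a i₁ * (starRingEnd ℂ) (a i₂) * z)
      (rowProd h (σ i₁) (σ i₂)) := by
    unfold rowProd
    rw [Multiset.map_map]
    have : ∀ f : Fin n → ℂ, Multiset.map (f ∘ τ) Finset.univ.val
        = Multiset.map f Finset.univ.val := fun f =>
      (map_univ_eq_iff' _ _).2 ⟨τ, rfl⟩
    conv_rhs => rw [← this]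
    refine Multiset.map_congr rfl fun j _ => ?_
    simp only [Function.comp, H, map_mul]
    linear_combination (a i₁ * (starRingEnd ℂ) (a i₂) * h (σ i₁) (τ j) *
      (starRingEnd ℂ) (h (σ i₂) (τ j))) * mul_conj_one (hb j)
  rw [e1, hxy]
  simp only [Multiset.insert_eq_cons, Multiset.map_cons, Multiset.map_singleton]
  congr! 2 <;> ring_nf

/-- Exponents of the Tao matrix. -/
def TaoE : Fin 6 → Fin 6 → ZMod 3 :=
  ![![0, 0, 0, 0, 0, 0], ![0, 0, 1, 1, 2, 2], ![0, 1, 0, 2, 2, 1],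
    ![0, 1, 2, 0, 1, 2], ![0, 2, 2, 1, 0, 1], ![0, 2, 1, 2, 1, 0]]

theorem TaoM_eq (i j : Fin 6) : TaoM i j = ee (TaoE i j) := by
  fin_cases i <;> fin_cases j <;> simp [TaoM, TaoE, ee_zero, ee_one, ee_two]

theorem Tao_ternary (i₁ i₂ : Fin 6) (hi : i₁ ≠ i₂) : TernaryPair TaoM i₁ i₂ := by
  refine ⟨1, 1, by simp, by simp, ?_⟩
  have h1 : rowProd TaoM i₁ i₂ = Multiset.map ee
      (Multiset.map (fun k => TaoE i₁ k - TaoE i₂ k) Finset.univ.val) := by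
    unfold rowProd
    rw [Multiset.map_map]
    refine Multiset.map_congr rfl fun j _ => ?_
    simp [TaoM_eq, ee_sub]
  have h2 : ∀ i₁ i₂ : Fin 6, i₁ ≠ i₂ →
    Multiset.map (fun k => TaoE i₁ k - TaoE i₂ k) Finset.univ.val = {0, 1, 2, 0, 1, 2} := by
    decide
  rw [h1, h2 _ _ hi]
  simp [ee_zero, ee_one, ee_two]

/-! ### Local structure of ternary sequences -/

/-- A sequence of six numbers that is ternary. -/
def Tern (g : Fin 6 → ℂ) : Prop :=
  ∃ (x y : ℂ) (σ : Equiv.Perm (Fin 6)), ‖x‖ = 1 ∧ ‖y‖ = 1 ∧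
    g = ![x, ω * x, ω ^ 2 * x, y, ω * y, ω ^ 2 * y] ∘ σ

theorem TernaryPair.tern {h : Matrix (Fin 6) (Fin 6) ℂ} {i₁ i₂ : Fin 6}
    (T : TernaryPair h i₁ i₂) : Tern (fun k => h i₁ k * (starRingEnd ℂ) (h i₂ k)) := by
  obtain ⟨x, y, hx, hy, H⟩ := T
  have : ({x, ω * x, ω ^ 2 * x, y, ω * y, ω ^ 2 * y} : Multiset ℂ) =
    Multiset.map ![x, ω * x, ω ^ 2 * x, y, ω * y, ω ^ 2 * y] Finset.univ.val := rfl
  unfold rowProd at H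
  rw [this] at H
  obtain ⟨σ, h⟩ := (map_univ_eq_iff' _ _).1 H
  exact ⟨x, y, σ, hx, hy, h⟩

/-- the block of an index -/
def blk : Fin 6 → Bool := ![true, true, true, false, false, false]

/-- the position of an index in its block -/
def pos3 : Fin 6 → ZMod 3 := ![0, 1, 2, 0, 1, 2]

theorem G_eq (x y : ℂ) (i : Fin 6) :
    (![x, ω * x, ω ^ 2 * x, y, ω * y, ω ^ 2 * y] : Fin 6 → ℂ) i
      = ee (pos3 i) * (if blk i then x else y) := by
  fin_cases i <;> simp [pos3, blk, ee_zero, ee_one, ee_two]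

theorem blk_pos : ∀ i j : Fin 6, blk i = blk j → pos3 i = pos3 j → i = j := by decide

theorem Tern.exists' {g : Fin 6 → ℂ} (T : Tern g) : ∃ (x y : ℂ) (σ : Equiv.Perm (Fin 6)),
    x ≠ 0 ∧ y ≠ 0 ∧ ∀ i, g i = ee (pos3 (σ i)) * (if blk (σ i) then x else y) := by
  obtain ⟨x, y, σ, hx, hy, rfl⟩ := T
  refine ⟨x, y, σ, ?_, ?_, fun i => ?_⟩
  · rintro rfl; simp at hx
  · rintro rfl; simp at hy
  · simp only [Function.comp]; exact G_eq _ _ _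

theorem Tern.no_three {g : Fin 6 → ℂ} (T : Tern g) {a b c : Fin 6} (hab : a ≠ b) (hac : a ≠ c)
    (hbc : b ≠ c) (h1 : g a = g b) (h2 : g a = g c) : False := by
  obtain ⟨x, y, σ, hx, hy, h⟩ := T.exists'
  have key : ∀ i j, i ≠ j → g i = g j → blk (σ i) ≠ blk (σ j) := by
    intro i j hij hg hb
    apply hij
    apply σ.injective
    refine blk_pos _ _ hb (ee_inj ?_)
    rw [h, h, hb] at hg
    refine mul_right_cancel₀ ?_ hg
    split_ifs <;> assumption
  have k1 := key a b hab h1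
  have k2 := key a c hac h2
  have k3 := key b c hbc (h1.symm.trans h2)
  revert k1 k2 k3
  cases blk (σ a) <;> cases blk (σ b) <;> cases blk (σ c) <;> simp

theorem Tern.cube_cases {g : Fin 6 → ℂ} (T : Tern g) :
    (∀ i j, g i ^ 3 = g j ^ 3) ∨
    (Function.Injective g ∧ (∀ i j k, g i ^ 3 = g j ^ 3 ∨ g i ^ 3 = g k ^ 3 ∨ g j ^ 3 = g k ^ 3) ∧
      ∀ i, (Finset.univ.filter (fun l => g l ^ 3 = g i ^ 3)).card = 3) := by
  obtain ⟨x, y, σ, hx, hy, h⟩ := T.exists'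
  have hc : ∀ i, g i ^ 3 = if blk (σ i) then x ^ 3 else y ^ 3 := by
    intro i; rw [h, mul_pow, ee_cube, one_mul]; split_ifs <;> rfl
  by_cases hxy : x ^ 3 = y ^ 3
  · left; intro i j; rw [hc, hc, hxy]; simp
  · right
    have hb : ∀ i j, g i ^ 3 = g j ^ 3 ↔ blk (σ i) = blk (σ j) := by
      intro i j; rw [hc, hc]
      have := Ne.symm hxy
      cases blk (σ i) <;> cases blk (σ j) <;> simp [hxy, this]
    refine ⟨fun i j hij => ?_, fun i j k => ?_, fun i => ?_⟩
    · have hbb := (hb i j).1 (by rw [hij])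
      apply σ.injective
      refine blk_pos _ _ hbb (ee_inj ?_)
      rw [h, h, hbb] at hij
      refine mul_right_cancel₀ ?_ hij
      split_ifs <;> assumption
    · rw [hb, hb, hb]
      cases blk (σ i) <;> cases blk (σ j) <;> cases blk (σ k) <;> simp
    · simp only [hb]
      have : ∀ b, (Finset.univ.filter (fun l => blk l = b)).card = 3 := by decide
      rw [← this (blk (σ i))]
      refine Finset.card_bij (fun l _ => σ l) (by simp) (by simp) ?_
      intro l hl
      exact ⟨σ.symm l, by simpa using hl, by simp⟩

theorem Tern.balanced {d : Fin 6 → ZMod 3} (T : Tern (fun k => ee (d k))) (c : ZMod 3) :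
    (Finset.univ.filter (fun l => d l = c)).card = 2 := by
  obtain ⟨x, y, σ, hx, hy, h⟩ := T.exists'
  have hx3 : x ^ 3 = 1 := by
    have := congrArg (· ^ 3) (h (σ.symm 0))
    simpa [mul_pow, ee_cube, blk] using this.symm
  have hy3 : y ^ 3 = 1 := by
    have := congrArg (· ^ 3) (h (σ.symm 3))
    simpa [mul_pow, ee_cube, blk] using this.symm
  obtain ⟨a, rfl⟩ := exists_ee hx3
  obtain ⟨b, rfl⟩ := exists_ee hy3
  have hd : ∀ i, d i = pos3 (σ i) + (if blk (σ i) then a else b) := by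
    intro i; apply ee_inj; rw [h, ee_add]; split_ifs <;> rfl
  have key : ∀ a b c : ZMod 3, (Finset.univ.filter
      (fun l => pos3 l + (if blk l then a else b) = c)).card = 2 := by decide
  rw [← key a b c]
  refine Finset.card_bij (fun l _ => σ l) (by simp [hd]) (by simp) ?_
  intro l hl
  exact ⟨σ.symm l, by simpa [hd] using hl, by simp⟩

/-! ### Normalised matrices have entries in the cube roots of unity -/

theorem same_set {s t : Fin 6 → ℂ} (hs : Tern s) (ht : Tern t) (s0 : s 0 = 1) (t0 : t 0 = 1)
    (nt : ∀ k, ‖t k‖ = 1)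
    (hst : Tern (fun k => s k * (starRingEnd ℂ) (t k)))
    (bs : ∃ l, s l ^ 3 ≠ 1) (bt : ∃ l, t l ^ 3 ≠ 1) (k : Fin 6) : s k ^ 3 = 1 ↔ t k ^ 3 = 1 := by
  classical
  obtain ⟨ls, bs⟩ := bs
  obtain ⟨lt, bt⟩ := bt
  rcases hs.cube_cases with h | ⟨-, hs2, hs3⟩
  · exact absurd (h ls 0) (by simpa [s0] using bs)
  rcases ht.cube_cases with h | ⟨-, ht2, ht3⟩
  · exact absurd (h lt 0) (by simpa [t0] using bt)
  have hs3 := hs3 0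
  have ht3 := ht3 0
  have hs2 : ∀ l, s l ^ 3 = 1 ∨ s l ^ 3 = s ls ^ 3 := by
    intro l
    rcases hs2 l ls 0 with h | h | h
    · exact Or.inr h
    · left; simpa [s0] using h
    · exact absurd h (by simpa [s0] using bs)
  have ht2 : ∀ l, t l ^ 3 = 1 ∨ t l ^ 3 = t lt ^ 3 := by
    intro l
    rcases ht2 l lt 0 with h | h | h
    · exact Or.inr h
    · left; simpa [t0] using h
    · exact absurd h (by simpa [t0] using bt)
  have hc : ∀ l, (s l * (starRingEnd ℂ) (t l)) ^ 3 = 1 ↔ s l ^ 3 = t l ^ 3 := by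
    intro l
    have h1 : t l ^ 3 * (starRingEnd ℂ) (t l) ^ 3 = 1 := by
      rw [← mul_pow, mul_conj_one (nt l), one_pow]
    have h2 : (starRingEnd ℂ) (t l) ^ 3 ≠ 0 := by intro h; simp [h] at h1
    rw [mul_pow, ← h1]
    exact mul_left_inj' h2
  simp only [s0, t0, one_pow] at hs3 ht3
  set A := Finset.univ.filter (fun l => s l ^ 3 = 1) with hA
  set B := Finset.univ.filter (fun l => t l ^ 3 = 1) with hB
  have mA : ∀ l, l ∈ A ↔ s l ^ 3 = 1 := by simp [hA]
  have mB : ∀ l, l ∈ B ↔ t l ^ 3 = 1 := by simp [hB]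
  rw [← mA, ← mB]
  rcases hst.cube_cases with h | ⟨-, -, h⟩
  · have := (hc k).1 (by rw [h k 0]; simp [s0, t0])
    rw [mA, mB, this]
  have h := h 0
  simp only [s0, t0, one_pow, map_one, mul_one, hc] at h
  by_cases hz : s ls ^ 3 = t lt ^ 3
  · exfalso
    have e : Finset.univ.filter (fun l => s l ^ 3 = t l ^ 3) = (A ∩ B) ∪ (A ∪ B)ᶜ := by
      ext l
      simp only [Finset.mem_filter, Finset.mem_univ, true_and, Finset.mem_union, Finset.mem_inter,
        Finset.mem_compl, mA, mB, not_or]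
      rcases hs2 l with h1 | h1 <;> rcases ht2 l with h2 | h2 <;> rw [h1, h2]
      · simp
      · have := Ne.symm bt; simp [bt, this]
      · simp [bs]
      · simp [bs, hz, bt]
    rw [e, Finset.card_union_of_disjoint] at h
    · have h1 := Finset.card_union_add_card_inter A B
      have h2 := Finset.card_compl_add_card (A ∪ B)
      rw [Fintype.card_fin] at h2
      omega
    · rw [Finset.disjoint_left]; intro l h1 h2
      simp only [Finset.mem_union, Finset.mem_inter, Finset.mem_compl] at h1 h2
      tauto
  · have e : Finset.univ.filter (fun l => s l ^ 3 = t l ^ 3) = A ∩ B := by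
      ext l
      simp only [Finset.mem_filter, Finset.mem_univ, true_and, Finset.mem_inter, mA, mB]
      rcases hs2 l with h1 | h1 <;> rcases ht2 l with h2 | h2 <;> rw [h1, h2]
      · simp
      · have := Ne.symm bt; simp [bt, this]
      · simp [bs]
      · simp [bs, hz]
    rw [e] at h
    have e1 := Finset.eq_of_subset_of_card_le (Finset.inter_subset_left (s₁ := A) (s₂ := B))
      (by omega)
    have e2 := Finset.eq_of_subset_of_card_le (Finset.inter_subset_right (s₁ := A) (s₂ := B))
      (by omega)
    rw [← e1, e2]

theorem all_cube {h : Matrix (Fin 6) (Fin 6) ℂ} (hn : ∀ i k, ‖h i k‖ = 1)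
    (h0 : ∀ k, h 0 k = 1) (h1 : ∀ i, h i 0 = 1)
    (T : ∀ i₁ i₂, i₁ ≠ i₂ → TernaryPair h i₁ i₂) : ∀ i k, h i k ^ 3 = 1 := by
  classical
  by_contra! hbad
  obtain ⟨i, k, hik⟩ := hbad
  have row : ∀ i, i ≠ 0 → Tern (h i) := by
    intro i hi
    have := (T i 0 hi).tern
    simpa [h0] using this
  have hi : i ≠ 0 := by rintro rfl; simp [h0] at hik
  -- the three columns where the bad row has cube one
  obtain ⟨p, q, hp, hq, hpq, hp3, hq3⟩ : ∃ p q : Fin 6, p ≠ 0 ∧ q ≠ 0 ∧ p ≠ q ∧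
      h i p ^ 3 = 1 ∧ h i q ^ 3 = 1 := by
    rcases (row i hi).cube_cases with H | ⟨-, -, H⟩
    · exact absurd (H k 0) (by simpa [h1] using hik)
    have H := H 0
    simp only [h1, one_pow] at H
    set A := Finset.univ.filter (fun l => h i l ^ 3 = 1) with hA
    have H0 : (0 : Fin 6) ∈ A := by simp [hA, h1]
    have := Finset.card_erase_of_mem H0
    rw [H] at this
    obtain ⟨p, q, hpq, he⟩ := Finset.card_eq_two.1 this
    have hp : p ∈ A.erase 0 := by simp [he]
    have hq : q ∈ A.erase 0 := by simp [he]
    simp only [hA, Finset.mem_erase, Finset.mem_filter, Finset.mem_univ, true_and] at hp hq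
    exact ⟨p, q, hp.1, hq.1, hpq, hp.2, hq.2⟩
  have inj_of_bad : ∀ g : Fin 6 → ℂ, Tern g → g 0 = 1 → (∃ l, g l ^ 3 ≠ 1) →
      Function.Injective g := by
    intro g hg g0 ⟨l, hl⟩
    rcases hg.cube_cases with H | ⟨H, -⟩
    · exact absurd (H l 0) (by simpa [g0] using hl)
    · exact H
  have dec1 : ∀ a b : ZMod 3, a ≠ 0 → b ≠ 0 → a ≠ b → b = -a := by decide
  have fromInj : ∀ g : Fin 6 → ℂ, Function.Injective g → g 0 = 1 → g p ^ 3 = 1 → g q ^ 3 = 1 →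
      ∃ d : ZMod 3, d ≠ 0 ∧ g p = ee d ∧ g q = ee (-d) := by
    intro g gi g0 gp gq
    obtain ⟨a, ha⟩ := exists_ee gp
    obtain ⟨b, hb⟩ := exists_ee gq
    have a0 : a ≠ 0 := by
      rintro rfl; rw [ee_zero] at ha; exact hp (gi (ha.trans g0.symm))
    have b0 : b ≠ 0 := by
      rintro rfl; rw [ee_zero] at hb; exact hq (gi (hb.trans g0.symm))
    have ab : a ≠ b := by
      rintro rfl; exact hpq (gi (ha.trans hb.symm))
    exact ⟨a, a0, ha, by rw [← dec1 a b a0 b0 ab, hb]⟩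
  obtain ⟨d, d0, hdp, hdq⟩ := fromInj (h i) (inj_of_bad _ (row i hi) (h1 i) ⟨k, hik⟩) (h1 i) hp3 hq3
  have dec2 : ∀ d a b : ZMod 3, d ≠ 0 → d - a ≠ 0 → -d - b ≠ 0 → d - a ≠ -d - b →
    ¬ (a = 0 ∧ b = 0) → a ≠ 0 ∧ b = -a := by decide
  have all : ∀ t, t ≠ 0 → ∃ d : ZMod 3, d ≠ 0 ∧ h t p = ee d ∧ h t q = ee (-d) := by
    intro t ht
    by_cases hti : i = t
    · subst hti; exact ⟨d, d0, hdp, hdq⟩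
    have Tit := (T i t hti).tern
    by_cases bt : ∃ l, h t l ^ 3 ≠ 1
    · have ss := same_set (row i hi) (row t ht) (h1 i) (h1 t) (hn t) Tit ⟨k, hik⟩ bt
      exact fromInj (h t) (inj_of_bad _ (row t ht) (h1 t) bt) (h1 t) ((ss p).1 hp3) ((ss q).1 hq3)
    · push Not at bt
      obtain ⟨a, ha⟩ := exists_ee (bt p)
      obtain ⟨b, hb⟩ := exists_ee (bt q)
      have ui := inj_of_bad _ Tit (by simp [h1]) ⟨k, by
        rw [mul_pow, ← map_pow, bt k, map_one, mul_one]; exact hik⟩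
      have up : h i p * (starRingEnd ℂ) (h t p) = ee (d - a) := by rw [hdp, ha, ee_sub]
      have uq : h i q * (starRingEnd ℂ) (h t q) = ee (-d - b) := by rw [hdq, hb, ee_sub]
      have u0 : h i 0 * (starRingEnd ℂ) (h t 0) = ee 0 := by simp [h1, ee_zero]
      have c1 : d - a ≠ 0 := fun e => hp (ui (by simp only [up, u0, e]))
      have c2 : -d - b ≠ 0 := fun e => hq (ui (by simp only [uq, u0, e]))
      have c3 : d - a ≠ -d - b := fun e => hpq (ui (by simp only [uq, up, e]))
      have c4 : ¬ (a = 0 ∧ b = 0) := by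
        rintro ⟨rfl, rfl⟩
        exact (row t ht).no_three hp.symm hq.symm hpq (by rw [h1, ha, ee_zero])
          (by rw [h1, hb, ee_zero])
      obtain ⟨e1, e2⟩ := dec2 d a b d0 c1 c2 c3 c4
      exact ⟨a, e1, ha, by rw [hb, e2]⟩
  have no2 : ∀ s t, s ≠ t → ∀ d : ZMod 3, h s p = ee d → h s q = ee (-d) → h t p = ee d →
      h t q = ee (-d) → False := by
    intro s t hst d s1 s2 t1 t2
    refine (T s t hst).tern.no_three hp.symm hq.symm hpq ?_ ?_
    · simp only [h1, s1, t1, ee_sub, sub_self, ee_zero]; simp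
    · simp only [h1, s2, t2, ee_sub, sub_self, ee_zero]; simp
  obtain ⟨d1, n1, p1, q1⟩ := all 1 (by decide)
  obtain ⟨d2, n2, p2, q2⟩ := all 2 (by decide)
  obtain ⟨d3, n3, p3, q3⟩ := all 3 (by decide)
  have dec3 : ∀ a b c : ZMod 3, a ≠ 0 → b ≠ 0 → c ≠ 0 → a = b ∨ a = c ∨ b = c := by decide
  rcases dec3 d1 d2 d3 n1 n2 n3 with rfl | rfl | rfl
  · exact no2 1 2 (by decide) _ p1 q1 p2 q2
  · exact no2 1 3 (by decide) _ p1 q1 p3 q3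
  · exact no2 2 3 (by decide) _ p2 q2 p3 q3

/-! ### The combinatorial classification over `ZMod 3` -/

/-- Every value is attained exactly twice. -/
def Bal (v : Fin 6 → ZMod 3) : Prop :=
  ∀ c, (Finset.univ.filter (fun l => v l = c)).card = 2

instance : DecidablePred Bal := fun v => by unfold Bal; infer_instance

/-- The candidates for the rows other than the first two. -/
def cand : Fin 9 → Fin 6 → ZMod 3 :=
  ![![0, 0, 2, 2, 1, 1], ![0, 1, 0, 2, 1, 2], ![0, 1, 0, 2, 2, 1], ![0, 1, 2, 0, 1, 2],
    ![0, 1, 2, 0, 2, 1], ![0, 2, 1, 2, 0, 1], ![0, 2, 1, 2, 1, 0], ![0, 2, 2, 1, 0, 1],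
    ![0, 2, 2, 1, 1, 0]]

/-- which of the two families a candidate belongs to -/
def fam : Fin 9 → Fin 3 := ![0, 1, 2, 2, 1, 1, 2, 2, 1]

theorem cand_of : ∀ a b c d e : ZMod 3, Bal ![0, a, b, c, d, e] →
    Bal (fun k => TaoE 1 k - ![0, a, b, c, d, e] k) → ∃ i, ![0, a, b, c, d, e] = cand i := by
  decide +kernel

theorem clique : ∀ i j : Fin 9, Bal (fun k => cand i k - cand j k) →
    ∀ k : Fin 9, Bal (fun l => cand i l - cand k l) → Bal (fun l => cand j l - cand k l) →
    ∀ m : Fin 9, Bal (fun l => cand i l - cand m l) → Bal (fun l => cand j l - cand m l) →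
    Bal (fun l => cand k l - cand m l) →
    (fam i = 1 ∧ fam j = 1 ∧ fam k = 1 ∧ fam m = 1) ∨
    (fam i = 2 ∧ fam j = 2 ∧ fam k = 2 ∧ fam m = 2) := by
  decide +kernel

theorem fam_one : ∀ i, fam i = 1 →
    ∃ r, ∀ k, cand i (Equiv.swap (4 : Fin 6) 5 k) = TaoE r k := by decide +kernel

theorem fam_two : ∀ i, fam i = 2 → ∃ r, ∀ k, cand i k = TaoE r k := by decide +kernel

theorem Bal.comp {v : Fin 6 → ZMod 3} (h : Bal v) (τ : Equiv.Perm (Fin 6)) (a : ZMod 3) :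
    Bal (fun k => v (τ k) + a) := by
  intro c
  rw [← h (c - a)]
  refine Finset.card_bij (fun l _ => τ l) ?_ (by simp) ?_
  · intro l; simp [eq_sub_iff_add_eq]
  · intro l hl
    exact ⟨τ.symm l, by simpa [eq_sub_iff_add_eq] using hl, by simp⟩

theorem classify (M : Fin 6 → Fin 6 → ZMod 3) (M0 : ∀ k, M 0 k = 0) (M1 : ∀ k, M 1 k = TaoE 1 k)
    (Mc : ∀ i, M i 0 = 0) (B : ∀ i j, i ≠ j → Bal (fun k => M i k - M j k)) :
    ∃ τ : Equiv.Perm (Fin 6), ∀ i, ∃ r, ∀ k, M i (τ k) = TaoE r k := by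
  have hc : ∀ i, i ≠ 0 → i ≠ 1 → ∃ c, M i = cand c := by
    intro i hi0 hi1
    have e : M i = ![0, M i 1, M i 2, M i 3, M i 4, M i 5] := by
      funext k; fin_cases k <;> simp [Mc]
    have b1 := B i 0 hi0
    have b2 := B 1 i hi1.symm
    simp only [M0, sub_zero, M1] at b1 b2
    obtain ⟨c, hc⟩ := cand_of (M i 1) (M i 2) (M i 3) (M i 4) (M i 5) (by rw [← e]; exact b1)
      (by rw [← e]; exact b2)
    exact ⟨c, e.trans hc⟩
  obtain ⟨c2, e2⟩ := hc 2 (by decide) (by decide)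
  obtain ⟨c3, e3⟩ := hc 3 (by decide) (by decide)
  obtain ⟨c4, e4⟩ := hc 4 (by decide) (by decide)
  obtain ⟨c5, e5⟩ := hc 5 (by decide) (by decide)
  have key := clique c2 c3 (by rw [← e2, ← e3]; exact B 2 3 (by decide))
    c4 (by rw [← e2, ← e4]; exact B 2 4 (by decide)) (by rw [← e3, ← e4]; exact B 3 4 (by decide))
    c5 (by rw [← e2, ← e5]; exact B 2 5 (by decide)) (by rw [← e3, ← e5]; exact B 3 5 (by decide))
    (by rw [← e4, ← e5]; exact B 4 5 (by decide))
  have z0 : ∀ k, TaoE 0 k = 0 := by decide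
  have z1 : ∀ k, TaoE 1 (Equiv.swap (4 : Fin 6) 5 k) = TaoE 1 k := by decide
  rcases key with ⟨f2, f3, f4, f5⟩ | ⟨f2, f3, f4, f5⟩
  · refine ⟨Equiv.swap 4 5, fun i => ?_⟩
    fin_cases i
    · exact ⟨0, fun k => by rw [z0]; exact M0 _⟩
    · exact ⟨1, fun k => by rw [← z1]; exact M1 _⟩
    · have := fam_one _ f2; rw [← e2] at this; exact this
    · have := fam_one _ f3; rw [← e3] at this; exact this
    · have := fam_one _ f4; rw [← e4] at this; exact this
    · have := fam_one _ f5; rw [← e5] at this; exact this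
  · refine ⟨Equiv.refl _, fun i => ?_⟩
    fin_cases i
    · exact ⟨0, fun k => by rw [z0]; exact M0 _⟩
    · exact ⟨1, fun k => M1 _⟩
    · have := fam_two _ f2; rw [← e2] at this; exact this
    · have := fam_two _ f3; rw [← e3] at this; exact this
    · have := fam_two _ f4; rw [← e4] at this; exact this
    · have := fam_two _ f5; rw [← e5] at this; exact this

theorem classify' (M : Fin 6 → Fin 6 → ZMod 3) (M0 : ∀ k, M 0 k = 0)
    (B : ∀ i j, i ≠ j → Bal (fun k => M i k - M j k)) :
    ∃ (σ τ : Equiv.Perm (Fin 6)) (a : Fin 6 → ZMod 3), ∀ r k,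
      TaoE r k = a r + M (σ r) (τ k) := by
  have hc : ∀ c, Fintype.card {l // TaoE 1 l = c} = Fintype.card {l // M 1 l = c} := by
    intro c
    have b := B 1 0 (by decide) c
    simp only [M0, sub_zero] at b
    have b' : ∀ c, (Finset.univ.filter (fun l => TaoE 1 l = c)).card = 2 := by decide
    rw [Fintype.card_subtype, Fintype.card_subtype, b, b']
  let τ : Equiv.Perm (Fin 6) := Equiv.ofFiberEquiv fun c => Fintype.equivOfCardEq (hc c)
  have hτ : ∀ l, M 1 (τ l) = TaoE 1 l := fun l => Equiv.ofFiberEquiv_map _ l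
  have B' : ∀ i j, i ≠ j → Bal (fun k => (M i (τ k) - M i (τ 0)) - (M j (τ k) - M j (τ 0))) := by
    intro i j hij
    have := (B i j hij).comp τ (M j (τ 0) - M i (τ 0))
    convert this using 2
    ring
  have t0 : TaoE 1 0 = 0 := by decide
  obtain ⟨τ', H⟩ := classify (fun i k => M i (τ k) - M i (τ 0)) (by simp [M0])
    (by simp [hτ, t0]) (by simp) B'
  choose ρ hρ using H
  have inj : Function.Injective ρ := by
    intro i j hij
    by_contra hne
    have b := (B' i j hne).comp τ' 0 1
    simp only [hρ, hij, sub_self, add_zero] at b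
    revert b; decide
  let e : Equiv.Perm (Fin 6) := Equiv.ofBijective ρ (Finite.injective_iff_bijective.1 inj)
  refine ⟨e.symm, τ'.trans τ, fun r => - M (e.symm r) (τ 0), fun r k => ?_⟩
  have h1 := hρ (e.symm r) k
  have h2 : ρ (e.symm r) = r := e.apply_symm_apply r
  rw [h2] at h1
  rw [← h1, Equiv.trans_apply]; ring

theorem forward (h : Matrix (Fin 6) (Fin 6) ℂ) (hn : ∀ i k, ‖h i k‖ = 1)
    (T : ∀ i₁ i₂ : Fin 6, i₁ ≠ i₂ → TernaryPair h i₁ i₂) : MatEquiv h TaoM := by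
  let g : Matrix (Fin 6) (Fin 6) ℂ := fun i k =>
    ((starRingEnd ℂ) (h i 0) * h 0 0) * (starRingEnd ℂ) (h 0 k) * h i k
  have hg : MatEquiv h g := ⟨Equiv.refl _, Equiv.refl _, fun i => (starRingEnd ℂ) (h i 0) * h 0 0,
    fun k => (starRingEnd ℂ) (h 0 k), by simp [hn], by simp [hn], fun i k => rfl⟩
  refine hg.trans' ?_
  have Tg := ternary_equiv hg T
  have g0 : ∀ k, g 0 k = 1 := by
    intro k
    have h1 := mul_conj_one (hn 0 0)
    have h2 := mul_conj_one (hn 0 k)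
    simp only [g]
    linear_combination h1 * (h 0 k * (starRingEnd ℂ) (h 0 k)) + h2
  have g1 : ∀ i, g i 0 = 1 := by
    intro i
    have h1 := mul_conj_one (hn 0 0)
    have h2 := mul_conj_one (hn i 0)
    simp only [g]
    linear_combination h1 * (h i 0 * (starRingEnd ℂ) (h i 0)) + h2
  have gn : ∀ i k, ‖g i k‖ = 1 := by intro i k; simp [g, hn]
  have gc := all_cube gn g0 g1 Tg
  choose M hM using fun i k => exists_ee (gc i k)
  obtain ⟨σ, τ, a, H⟩ := classify' M (fun k => ee_inj (by rw [← hM, g0, ee_zero])) (by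
    intro i j hij
    have := (Tg i j hij).tern
    simp only [hM, ee_sub] at this
    exact this.balanced)
  refine ⟨σ, τ, fun r => ee (a r), fun _ => 1, fun i => ee_norm _, by simp, fun i k => ?_⟩
  rw [TaoM_eq, H, ee_add, hM]; ring

/-- A 6×6 complex Hadamard matrix has all pairs of distinct rows ternary
iff it is equivalent to the Tao matrix. -/
theorem stmt_14 (h : Matrix (Fin 6) (Fin 6) ℂ) (hH : IsCHM h) :
    (∀ i₁ i₂ : Fin 6, i₁ ≠ i₂ → TernaryPair h i₁ i₂) ↔ MatEquiv h TaoM :=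
  ⟨forward h hH.1, fun H => ternary_equiv H.symm' Tao_ternary⟩
end
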